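/- Let H be a complex Hilbert space and T : H →L[ℂ] H a bounded self-adjoint operator with 0 ≤ T, and for λ > 0 let R_λ = (λ•1 + T)⁻¹. Then for all λ, μ > 0, every g ∈ H, and f = √T g, one has ‖T (R_λ f) − T (R_μ f)‖ ≤ |λ − μ| · ‖g‖ / (2 √(min λ μ)). -/

import Mathlib

open scoped InnerProductSpace

variable {H : Type*} [NormedAddCommGroup H] [InnerProductSpace ℂ H] [CompleteSpace H]

/-- The resolventOp `R_λ = (λ • 1 + T)⁻¹` of `-T`, as `Ring.inverse`. -/
noncomputable def resolventOp (T : H →L[ℂ] H) (l : ℝ) : H →L[ℂ] H :=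
  Ring.inverse (l • (1 : H →L[ℂ] H) + T)
/-- Cauchy-type estimate: `‖T R_λ f − T R_μ f‖ ≤ |λ − μ| ‖g‖ / (2 √(min λ μ))`
for `f = √T g`. -/
theorem norm_T_resolvent_sub_le (T : H →L[ℂ] H) (hT : IsSelfAdjoint T)
    (hpos : 0 ≤ T) {l m : ℝ} (hl : 0 < l) (hm : 0 < m) (g : H) :
    ‖T (resolventOp T l (CFC.sqrt T g)) - T (resolventOp T m (CFC.sqrt T g))‖
      ≤ |l - m| * ‖g‖ / (2 * Real.sqrt (min l m)) := by
  have hS0 : 0 ≤ CFC.sqrt T := CFC.sqrt_nonneg T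
  have hSS : CFC.sqrt T * CFC.sqrt T = T := CFC.sqrt_mul_sqrt_self T hpos
  have hSsa : IsSelfAdjoint (CFC.sqrt T) := IsSelfAdjoint.of_nonneg hS0
  generalize CFC.sqrt T = S at *
  have hSS' : ∀ x, S (S x) = T x := fun x => by
    rw [← hSS]; rfl
  have hinner : ∀ x, (inner ℂ x (T x) : ℂ).re = ‖S x‖ ^ 2 := fun x => by
    have h1 : inner ℂ (S x) (S x) = inner ℂ x (S (S x)) :=
      (ContinuousLinearMap.isSelfAdjoint_iff_isSymmetric.mp hSsa) x (S x)
    rw [← hSS', ← h1]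
    exact inner_self_eq_norm_sq (𝕜 := ℂ) (S x)
  have hunit : ∀ a : ℝ, 0 < a → IsUnit (a • (1 : H →L[ℂ] H) + T) := by
    intro a ha
    refine CStarAlgebra.isUnit_of_le (a • (1 : H →L[ℂ] H)) (le_add_of_nonneg_right hpos) ?_
    have h0 : (0 : H →L[ℂ] H) ≤ a • 1 := smul_nonneg ha.le zero_le_one
    exact IsUnit.isStrictlyPositive ((isUnit_one).smul (Units.mk0 a ha.ne')) h0
  have hexp : ∀ (a : ℝ) (z : H), ‖a • z + T z‖ ^ 2
      = a ^ 2 * ‖z‖ ^ 2 + 2 * a * ‖S z‖ ^ 2 + ‖T z‖ ^ 2 := by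
    intro a z
    have h := norm_add_sq (𝕜 := ℂ) (a • z) (T z)
    rw [h, norm_smul, mul_pow, Real.norm_eq_abs, sq_abs, ← hinner z]
    have : (inner ℂ (a • z) (T z) : ℂ) = (a : ℂ) * inner ℂ z (T z) := by
      rw [← Complex.coe_smul, inner_smul_left]; simp
    rw [this]
    simp
    ring
  have hR : ∀ a : ℝ, 0 < a → ∀ x, a • resolventOp T a x + T (resolventOp T a x) = x := by
    intro a ha x
    have h := Ring.mul_inverse_cancel _ (hunit a ha)
    simpa [resolventOp] using congrArg (fun A : H →L[ℂ] H => A x) h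
  have hR' : ∀ a : ℝ, 0 < a → ∀ x, resolventOp T a (a • x + T x) = x := by
    intro a ha x
    have h := Ring.inverse_mul_cancel _ (hunit a ha)
    simpa [resolventOp] using congrArg (fun A : H →L[ℂ] H => A x) h
  -- contraction
  have hcontr : ∀ x, ‖T (resolventOp T l x)‖ ≤ ‖x‖ := by
    intro x
    have h := hexp l (resolventOp T l x)
    rw [hR l hl] at h
    refine le_of_sq_le_sq ?_ (norm_nonneg _)
    rw [h]
    have : 0 ≤ l ^ 2 * ‖resolventOp T l x‖ ^ 2 + 2 * l * ‖S (resolventOp T l x)‖ ^ 2 := by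
      positivity
    linarith
  -- key bound
  have hkey : ‖resolventOp T m (S g)‖ ≤ ‖g‖ / (2 * Real.sqrt m) := by
    set z := resolventOp T m g with hz
    have hzg : m • z + T z = g := hR m hm g
    have hy : resolventOp T m (S g) = S z := by
      have : S g = m • S z + T (S z) := by
        rw [← hSS' (S z), hSS' z]
        nth_rw 1 [← hzg]
        rw [map_add, S.map_smul_of_tower]
      rw [this, hR' m hm]
    rw [hy, le_div_iff₀ (by positivity)]
    refine le_of_sq_le_sq ?_ (norm_nonneg _)
    have h := hexp m z
    rw [hzg] at h
    have h2 : ‖S z‖ ^ 2 ≤ ‖z‖ * ‖T z‖ := by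
      rw [← hinner]
      exact re_inner_le_norm (𝕜 := ℂ) z (T z)
    rw [h, mul_pow, mul_pow, Real.sq_sqrt hm.le]
    nlinarith [sq_nonneg (m * ‖z‖ - ‖T z‖), mul_le_mul_of_nonneg_left h2 hm.le]
  have hid : T (resolventOp T l (S g)) - T (resolventOp T m (S g))
      = (m - l) • T (resolventOp T l (resolventOp T m (S g))) := by
    set w := resolventOp T m (S g) with hw
    have h1 : S g = (l • w + T w) + (m - l) • w := by
      rw [← hR m hm (S g), ← hw, sub_smul]; abel
    rw [h1, map_add, hR' l hl, ContinuousLinearMap.map_smul_of_tower, map_add,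
      ContinuousLinearMap.map_smul_of_tower]
    abel
  rw [hid, norm_smul, Real.norm_eq_abs, abs_sub_comm, mul_div_assoc]
  refine mul_le_mul_of_nonneg_left ((hcontr _).trans (hkey.trans ?_)) (abs_nonneg _)
  have hmin : 0 < min l m := lt_min hl hm
  have := Real.sqrt_le_sqrt (min_le_right l m)
  have h0 := Real.sqrt_pos.mpr hmin
  gcongr
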